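/- Let p be a prime and g a positive integer, and set q = p^g. Then f^[g](x) − x ≡ x^q − x modulo the ideal p·ℤ[x], i.e., every coefficient of the polynomial (f^[g](x) − x) − (x^q − x) is divisible by p. -/

import Mathlib

open Polynomial

/-- The polynomials `m n ∈ ℤ[x]` defined by `m 0 = 1`, `m 1 = X`,
`m n = X * m (n-1) - m (n-2)` for `n ≥ 2` (note `m 2 = X^2 - 1`). -/
noncomputable def m : ℕ → Polynomial ℤ
  | 0 => 1
  | 1 => X
  | (n + 2) => X * m (n + 1) - m n

/-- `fIter p i` is the `i`-fold composition `f ∘ ⋯ ∘ f` of `f = m p - m (p-2)`,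
with `fIter p 0 = X`. -/
noncomputable def fIter (p : ℕ) : ℕ → Polynomial ℤ
  | 0 => X
  | (i + 1) => (m p - m (p - 2)).comp (fIter p i)

theorem m_sub_eq_dickson : ∀ n : ℕ, m (n + 2) - m n = dickson 1 (1 : ℤ) (n + 2)
  | 0 => by
    rw [dickson_add_two]
    simp [m]
    ring
  | 1 => by
    rw [dickson_add_two, dickson_add_two]
    simp [m]
    ring
  | (n + 2) => by
    rw [dickson_add_two, ← m_sub_eq_dickson n, ← m_sub_eq_dickson (n + 1)]
    simp only [m, C_1]
    ring

theorem fIter_map (p : ℕ) (hp : p.Prime) (g : ℕ) :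
    (fIter p g).map (Int.castRingHom (ZMod p)) = X ^ (p ^ g) := by
  haveI : Fact p.Prime := ⟨hp⟩
  induction g with
  | zero => simp [fIter]
  | succ g ih =>
    obtain ⟨n, hn⟩ := Nat.exists_eq_add_of_le' hp.two_le
    have h : m p - m (p - 2) = dickson 1 (1 : ℤ) p := by
      have := m_sub_eq_dickson n
      rw [← hn] at this
      rw [← this, hn, Nat.add_sub_cancel]
    rw [fIter, Polynomial.map_comp, ih, h, map_dickson, map_one, dickson_one_one_zmod_p]
    simp [← pow_mul, pow_succ]

/-- For `p` prime, `g ≥ 1` and `q = p^g`, `f^[g](x) - x ≡ x^q - x (mod p ℤ[x])`: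
every coefficient of `(f^[g](x) - x) - (x^q - x)` is divisible by `p`. -/
theorem stmt_6 (p g : ℕ) (hp : p.Prime) (hg : 0 < g) :
    ∀ k : ℕ, (p : ℤ) ∣ ((fIter p g - X) - (X ^ (p ^ g) - X)).coeff k := by
  intro k
  have h : ((fIter p g - X) - (X ^ (p ^ g) - X)).map (Int.castRingHom (ZMod p)) = 0 := by
    simp [fIter_map p hp g]
  have h2 := congrArg (fun q => q.coeff k) h
  simp only [coeff_map, coeff_zero] at h2
  exact (ZMod.intCast_zmod_eq_zero_iff_dvd _ p).1 (by simpa using h2)
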